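/- arXiv:1810.11310 — 7 statements merged into one kernel-verified Lean document; each statement's English description precedes it below -/
import Mathlib

section
/- For each i ∈ {0,1,2,3}, the image σᵢΣ of the positive cone under σᵢ equals the following sector: σ₀Σ = {(x,y) : x > 0, 0 ≤ y < φ⁻¹x}, σ₁Σ = {(x,y) : x > 0, φ⁻¹x ≤ y < x}, σ₂Σ = {(x,y) : x > 0, x ≤ y < φx}, σ₃Σ = {(x,y) : x > 0, φx ≤ y}. Moreover these four sectors are pairwise disjoint and their union is Σ. -/
noncomputable section
open Matrix

noncomputable def φ : ℝ := (1 + Real.sqrt 5) / 2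

noncomputable def σ : Fin 4 → Matrix (Fin 2) (Fin 2) ℝ
  | 0 => !![1, φ; 0, 1]
  | 1 => !![φ, φ; 1, φ]
  | 2 => !![φ, 1; φ, φ]
  | 3 => !![1, 0; φ, 1]

/-- The positive cone Σ = {(x,y) : x > 0, y ≥ 0}. -/
def Cone : Set (Fin 2 → ℝ) := {p | 0 < p 0 ∧ 0 ≤ p 1}

/-- The sector Σᵢ = σᵢ Σ. -/
def Sector (i : Fin 4) : Set (Fin 2 → ℝ) := (fun p => (σ i).mulVec p) '' Cone

theorem phi_sq_aux : φ * φ = φ + 1 := by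
  have h : Real.sqrt 5 * Real.sqrt 5 = 5 := Real.mul_self_sqrt (by norm_num)
  unfold φ
  nlinarith

theorem phi_gt_aux : 1 < φ := by
  have h : (1:ℝ) < Real.sqrt 5 := by
    rw [Real.lt_sqrt] <;> norm_num
  unfold φ
  linarith

theorem phi_inv_aux : φ⁻¹ = φ - 1 := by
  have h := phi_gt_aux
  have h2 := phi_sq_aux
  exact inv_eq_of_mul_eq_one_right (by linarith)

theorem sector_aux (i : Fin 4) (a b c d : ℝ) (h : σ i = !![a, b; c, d])
    (hd : a * d - b * c = 1) (p : Fin 2 → ℝ) :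
    p ∈ Sector i ↔ 0 < d * p 0 - b * p 1 ∧ 0 ≤ a * p 1 - c * p 0 := by
  unfold Sector Cone
  rw [h]
  constructor
  · rintro ⟨q, ⟨h0, h1⟩, rfl⟩
    simp only [Matrix.mulVec, dotProduct, Fin.sum_univ_two, Matrix.of_apply, Matrix.cons_val_zero,
      Matrix.cons_val_one, Matrix.cons_val', Matrix.cons_val_fin_one]
    have e0 : d * (a * q 0 + b * q 1) - b * (c * q 0 + d * q 1) = q 0 := by
      linear_combination q 0 * hd
    have e1 : a * (c * q 0 + d * q 1) - c * (a * q 0 + b * q 1) = q 1 := by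
      linear_combination q 1 * hd
    rw [e0, e1]
    exact ⟨h0, h1⟩
  · rintro ⟨h0, h1⟩
    refine ⟨![d * p 0 - b * p 1, a * p 1 - c * p 0], ⟨by simpa using h0, by simpa using h1⟩, ?_⟩
    ext k
    fin_cases k
    · simp [Matrix.mulVec, dotProduct, Fin.sum_univ_two]
      linear_combination p 0 * hd
    · simp [Matrix.mulVec, dotProduct, Fin.sum_univ_two]
      linear_combination p 1 * hd

theorem stmt0 :
    Sector 0 = {p : Fin 2 → ℝ | 0 < p 0 ∧ 0 ≤ p 1 ∧ p 1 < φ⁻¹ * p 0} ∧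
    Sector 1 = {p : Fin 2 → ℝ | 0 < p 0 ∧ φ⁻¹ * p 0 ≤ p 1 ∧ p 1 < p 0} ∧
    Sector 2 = {p : Fin 2 → ℝ | 0 < p 0 ∧ p 0 ≤ p 1 ∧ p 1 < φ * p 0} ∧
    Sector 3 = {p : Fin 2 → ℝ | 0 < p 0 ∧ φ * p 0 ≤ p 1} ∧
    (∀ i j : Fin 4, i ≠ j → Disjoint (Sector i) (Sector j)) ∧
    (⋃ i, Sector i) = Cone := by
  have g := phi_gt_aux
  have s := phi_sq_aux
  have e0 : Sector 0 = {p : Fin 2 → ℝ | 0 < p 0 ∧ 0 ≤ p 1 ∧ p 1 < φ⁻¹ * p 0} := by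
    ext p
    rw [sector_aux 0 1 φ 0 1 rfl (by ring), phi_inv_aux]
    simp only [Set.mem_ofPred_eq]
    constructor
    · rintro ⟨h0, h1⟩
      have : 0 ≤ p 1 := by linarith
      refine ⟨by nlinarith, this, ?_⟩
      have := mul_pos (sub_pos.2 g) h0
      linear_combination this - p 1 * s
    · rintro ⟨h0, h1, h2⟩
      refine ⟨?_, by linarith⟩
      have := mul_pos (by linarith : 0 < φ) (sub_pos.2 h2)
      linear_combination this + p 0 * s
  have e1 : Sector 1 = {p : Fin 2 → ℝ | 0 < p 0 ∧ φ⁻¹ * p 0 ≤ p 1 ∧ p 1 < p 0} := by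
    ext p
    rw [sector_aux 1 φ φ 1 φ rfl (by linarith), phi_inv_aux]
    simp only [Set.mem_ofPred_eq]
    constructor
    · rintro ⟨h0, h1⟩
      have h2 : p 1 < p 0 := by nlinarith
      refine ⟨by nlinarith, ?_, h2⟩
      have := mul_nonneg (sub_pos.2 g).le h1
      linear_combination this + p 1 * s
    · rintro ⟨h0, h1, h2⟩
      refine ⟨by nlinarith, ?_⟩
      have := mul_nonneg (by linarith : 0 ≤ φ) (sub_nonneg.2 h1)
      linear_combination this - p 0 * s
  have e2 : Sector 2 = {p : Fin 2 → ℝ | 0 < p 0 ∧ p 0 ≤ p 1 ∧ p 1 < φ * p 0} := by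
    ext p
    rw [sector_aux 2 φ 1 φ φ rfl (by linarith)]
    simp only [Set.mem_ofPred_eq]
    constructor
    · rintro ⟨h0, h1⟩
      have h2 : p 0 ≤ p 1 := by nlinarith
      exact ⟨by nlinarith, h2, by linarith⟩
    · rintro ⟨h0, h1, h2⟩
      exact ⟨by linarith, by nlinarith⟩
  have e3 : Sector 3 = {p : Fin 2 → ℝ | 0 < p 0 ∧ φ * p 0 ≤ p 1} := by
    ext p
    rw [sector_aux 3 1 0 φ 1 rfl (by ring)]
    simp only [Set.mem_ofPred_eq]
    constructor
    · rintro ⟨h0, h1⟩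
      exact ⟨by linarith, by linarith⟩
    · rintro ⟨h0, h1⟩
      exact ⟨by linarith, by linarith⟩
  have key : ∀ x : ℝ, 0 < x → 0 < φ⁻¹ * x ∧ φ⁻¹ * x < x ∧ x < φ * x := by
    intro x hx
    refine ⟨by positivity, ?_, by nlinarith⟩
    have : φ⁻¹ < 1 := inv_lt_one_of_one_lt₀ g
    nlinarith
  refine ⟨e0, e1, e2, e3, ?_, ?_⟩
  · intro i j hij
    rw [Set.disjoint_left]
    intro p
    fin_cases i <;> fin_cases j <;> first
      | exact absurd rfl hij
      | (simp only [Fin.zero_eta, Fin.mk_one, Fin.reduceFinMk, e0, e1, e2, e3, Set.mem_ofPred_eq]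
         intro h h'
         obtain ⟨k0, k1, k2⟩ := key (p 0) h.1
         obtain ⟨-, h⟩ := h
         obtain ⟨-, h'⟩ := h'
         first
           | linarith [h.1, h.2, h'.1, h'.2]
           | linarith [h.1, h.2]
           | linarith [h'.1, h'.2])
  · ext p
    simp only [Set.mem_iUnion, Cone, Set.mem_ofPred_eq]
    constructor
    · rintro ⟨i, h⟩
      fin_cases i <;>
        simp only [Fin.zero_eta, Fin.mk_one, Fin.reduceFinMk, e0, e1, e2, e3, Set.mem_ofPred_eq] at h <;>
        obtain ⟨k0, k1, k2⟩ := key (p 0) h.1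
      · exact ⟨h.1, h.2.1⟩
      · exact ⟨h.1, by linarith [h.2.1]⟩
      · exact ⟨h.1, by linarith [h.2.1]⟩
      · exact ⟨h.1, by linarith [h.2]⟩
    · rintro ⟨h0, h1⟩
      by_cases c0 : p 1 < φ⁻¹ * p 0
      · exact ⟨0, by rw [e0]; exact ⟨h0, h1, c0⟩⟩
      by_cases c1 : p 1 < p 0
      · exact ⟨1, by rw [e1]; exact ⟨h0, not_lt.1 c0, c1⟩⟩
      by_cases c2 : p 1 < φ * p 0
      · exact ⟨2, by rw [e2]; exact ⟨h0, not_lt.1 c1, c2⟩⟩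
      exact ⟨3, by rw [e3]; exact ⟨h0, not_lt.1 c2⟩⟩
end
end

section
/- Define maps s, t on digits by s(0)=3, s(1)=2, s(2)=1, s(3)=0 and t(1)=3, t(2)=2, t(3)=1, and let S = [[0,1],[1,0]]. For every normalized nonempty word w = k₀k₁⋯kₙ over {0,1,2,3} (so kₙ ∈ {1,2,3}), let w* = s(k₀)s(k₁)⋯s(k_{n-1})t(kₙ). Then v(w*) = S·v(w); that is, the tree of directions is symmetric under reflection across the line y = x. -/
noncomputable section
open Matrix

abbrev Word := List (Fin 4)

noncomputable def vword (w : Word) : Fin 2 → ℝ := ((w.map σ).prod).mulVec ![1, 0]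

/-- The swap s on digits: s(0)=3, s(1)=2, s(2)=1, s(3)=0. -/
def sdig : Fin 4 → Fin 4
  | 0 => 3
  | 1 => 2
  | 2 => 1
  | 3 => 0

/-- The swap t on the last digit: t(1)=3, t(2)=2, t(3)=1 (value at 0 irrelevant). -/
def tdig : Fin 4 → Fin 4
  | 0 => 0
  | 1 => 3
  | 2 => 2
  | 3 => 1

theorem swap_comm_aux (k : Fin 4) :
    σ (sdig k) * (!![0, 1; 1, 0] : Matrix (Fin 2) (Fin 2) ℝ) = !![0, 1; 1, 0] * σ k := by
  fin_cases k <;> simp [σ, sdig]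

theorem swap_last_aux (k : Fin 4) (hk : k ≠ 0) :
    (σ (tdig k)).mulVec ![1, 0] =
      (!![0, 1; 1, 0] : Matrix (Fin 2) (Fin 2) ℝ).mulVec ((σ k).mulVec ![1, 0]) := by
  fin_cases k
  · simp at hk
  all_goals
    ext i
    fin_cases i <;> simp [σ, tdig, Matrix.mulVec, dotProduct, Fin.sum_univ_two]

theorem swap_word_aux (u : List (Fin 4)) (k : Fin 4) (hk : k ≠ 0) :
    vword (u.map sdig ++ [tdig k]) =
      (!![0, 1; 1, 0] : Matrix (Fin 2) (Fin 2) ℝ).mulVec (vword (u ++ [k])) := by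
  induction u with
  | nil => simpa [vword] using swap_last_aux k hk
  | cons a u ih =>
    have hv : ∀ (b : Fin 4) (x : Word), vword (b :: x) = (σ b).mulVec (vword x) := by
      intro b x
      simp only [vword, List.map_cons, List.prod_cons, Matrix.mulVec_mulVec]
    rw [List.map_cons, List.cons_append, List.cons_append, hv, hv, ih, Matrix.mulVec_mulVec,
      swap_comm_aux, Matrix.mulVec_mulVec]

theorem stmt7 (w : Word) (h : w ≠ []) (hn : w.getLast h ≠ 0) :
    vword (w.dropLast.map sdig ++ [tdig (w.getLast h)]) =
      (!![0, 1; 1, 0] : Matrix (Fin 2) (Fin 2) ℝ).mulVec (vword w) := by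
  have e := swap_word_aux w.dropLast (w.getLast h) hn
  rwa [List.dropLast_append_getLast h] at e
end
end

section
/- For every finite word τ over B, writing (a,b,c,d) = (a_τ, b_τ, c_τ, d_τ), the count vectors of the substituted words are: for r₀(τ): (a+d, b+c+d, c, d); for r₁(τ): (b+d, a+b+c+d, a+d, b+c+d); for r₂(τ): (b+c, a+b+d, b+d, a+b+c+d); for r₃(τ): (a, b, b+c, a+b+d). -/
inductive B : Type
  | l12 | l21 | l23 | l32 | l34 | l43 | l45 | l54
  deriving DecidableEq, BEq, Repr

open B

/-- The substitutions r₀, r₁, r₂, r₃ on the 8-letter alphabet B,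
where `l12` denotes the letter 1², etc. -/
def r : Fin 4 → B → List B
  | 0, l12 => [l21]
  | 0, l21 => [l12]
  | 0, l23 => [l12, l23, l34]
  | 0, l32 => [l43, l32, l21]
  | 0, l34 => [l43]
  | 0, l43 => [l34]
  | 0, l45 => [l34, l45]
  | 0, l54 => [l54, l43]
  | 1, l12 => [l34, l45]
  | 1, l21 => [l54, l43]
  | 1, l23 => [l54, l43, l32, l21]
  | 1, l32 => [l12, l23, l34, l45]
  | 1, l34 => [l12, l23, l34]
  | 1, l43 => [l43, l32, l21]
  | 1, l45 => [l43, l32]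
  | 1, l54 => [l23, l34]
  | 2, l12 => [l43, l32]
  | 2, l21 => [l23, l34]
  | 2, l23 => [l23, l34, l45]
  | 2, l32 => [l54, l43, l32]
  | 2, l34 => [l54, l43, l32, l21]
  | 2, l43 => [l12, l23, l34, l45]
  | 2, l45 => [l12, l23]
  | 2, l54 => [l32, l21]
  | 3, l12 => [l12, l23]
  | 3, l21 => [l32, l21]
  | 3, l23 => [l32]
  | 3, l32 => [l23]
  | 3, l34 => [l23, l34, l45]
  | 3, l43 => [l54, l43, l32]
  | 3, l45 => [l54]
  | 3, l54 => [l45]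

/-- Applying the substitution rᵢ letter by letter to a word. -/
def subst (i : Fin 4) (w : List B) : List B := (w.map (r i)).flatten

/-- a_τ : number of letters in {1², 2¹}. -/
def na (w : List B) : ℕ := w.count l12 + w.count l21
/-- d_τ : number of letters in {2³, 3²}. -/
def nd (w : List B) : ℕ := w.count l23 + w.count l32
/-- b_τ : number of letters in {3⁴, 4³}. -/
def nb (w : List B) : ℕ := w.count l34 + w.count l43
/-- c_τ : number of letters in {4⁵, 5⁴}. -/
def nc (w : List B) : ℕ := w.count l45 + w.count l54

theorem na_app (x y : List B) : na (x ++ y) = na x + na y := by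
  simp only [na, List.count_append]; omega

theorem nb_app (x y : List B) : nb (x ++ y) = nb x + nb y := by
  simp only [nb, List.count_append]; omega

theorem nc_app (x y : List B) : nc (x ++ y) = nc x + nc y := by
  simp only [nc, List.count_append]; omega

theorem nd_app (x y : List B) : nd (x ++ y) = nd x + nd y := by
  simp only [nd, List.count_append]; omega

theorem subst_cons (i : Fin 4) (x : B) (t : List B) : subst i (x :: t) = r i x ++ subst i t := rfl

theorem stmt11 (τ : List B) :
    (na (subst 0 τ) = na τ + nd τ ∧ nb (subst 0 τ) = nb τ + nc τ + nd τ ∧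
      nc (subst 0 τ) = nc τ ∧ nd (subst 0 τ) = nd τ) ∧
    (na (subst 1 τ) = nb τ + nd τ ∧ nb (subst 1 τ) = na τ + nb τ + nc τ + nd τ ∧
      nc (subst 1 τ) = na τ + nd τ ∧ nd (subst 1 τ) = nb τ + nc τ + nd τ) ∧
    (na (subst 2 τ) = nb τ + nc τ ∧ nb (subst 2 τ) = na τ + nb τ + nd τ ∧
      nc (subst 2 τ) = nb τ + nd τ ∧ nd (subst 2 τ) = na τ + nb τ + nc τ + nd τ) ∧
    (na (subst 3 τ) = na τ ∧ nb (subst 3 τ) = nb τ ∧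
      nc (subst 3 τ) = nb τ + nc τ ∧ nd (subst 3 τ) = na τ + nb τ + nd τ) := by
  induction τ with
  | nil => decide
  | cons x t ih =>
    have e : x :: t = [x] ++ t := rfl
    simp only [subst_cons, na_app, nb_app, nc_app, nd_app]
    simp only [e, na_app, nb_app, nc_app, nd_app]
    have k : (∀ x : B, (na (r 0 x) = na [x] + nd [x] ∧ nb (r 0 x) = nb [x] + nc [x] + nd [x] ∧
      nc (r 0 x) = nc [x] ∧ nd (r 0 x) = nd [x]) ∧
    (na (r 1 x) = nb [x] + nd [x] ∧ nb (r 1 x) = na [x] + nb [x] + nc [x] + nd [x] ∧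
      nc (r 1 x) = na [x] + nd [x] ∧ nd (r 1 x) = nb [x] + nc [x] + nd [x]) ∧
    (na (r 2 x) = nb [x] + nc [x] ∧ nb (r 2 x) = na [x] + nb [x] + nd [x] ∧
      nc (r 2 x) = nb [x] + nd [x] ∧ nd (r 2 x) = na [x] + nb [x] + nc [x] + nd [x]) ∧
    (na (r 3 x) = na [x] ∧ nb (r 3 x) = nb [x] ∧
      nc (r 3 x) = nb [x] + nc [x] ∧ nd (r 3 x) = na [x] + nb [x] + nd [x])) := by
      intro x
      cases x <;> decide
    obtain ⟨⟨k1, k2, k3, k4⟩, ⟨k5, k6, k7, k8⟩, ⟨k9, k10, k11, k12⟩, k13, k14, k15, k16⟩ := k x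
    obtain ⟨⟨h1, h2, h3, h4⟩, ⟨h5, h6, h7, h8⟩, ⟨h9, h10, h11, h12⟩, h13, h14, h15, h16⟩ := ih
    clear k e
    simp only [k1, k2, k3, k4, k5, k6, k7, k8, k9, k10, k11, k12, k13, k14, k15, k16,
      h1, h2, h3, h4, h5, h6, h7, h8, h9, h10, h11, h12, h13, h14, h15, h16]
    refine ⟨⟨?_, ?_, ?_, ?_⟩, ⟨?_, ?_, ?_, ?_⟩, ⟨?_, ?_, ?_, ?_⟩, ?_, ?_, ?_, ?_⟩ <;> first | trivial | ring
end

section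
/- Let w be any word obtained from the two-letter word 1²2¹ by applying a finite (possibly empty) composition r_{k₀}∘r_{k₁}∘⋯∘r_{kₙ} of the substitutions, with each kᵢ ∈ {0,1,2,3}. Then for each pair (a,b) ∈ {(1,2),(2,3),(3,4),(4,5)}, the number of occurrences of the letter aᵇ in w equals the number of occurrences of the letter bᵃ in w. -/
open B

theorem beq_iff_B (x y : B) : (x == y) = decide (x = y) := by
  cases x <;> cases y <;> rfl

theorem count_subst (i : Fin 4) (x : B) (w : List B) :
    (subst i w).count x =
      w.count l12 * (r i l12).count x + w.count l21 * (r i l21).count x +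
      w.count l23 * (r i l23).count x + w.count l32 * (r i l32).count x +
      w.count l34 * (r i l34).count x + w.count l43 * (r i l43).count x +
      w.count l45 * (r i l45).count x + w.count l54 * (r i l54).count x := by
  induction w with
  | nil => simp [subst]
  | cons z w ih =>
    have h : subst i (z :: w) = r i z ++ subst i w := by simp [subst]
    rw [h, List.count_append, ih]
    cases z <;> simp [List.count_cons, beq_iff_B] <;> ring

theorem stmt12 (ks : List (Fin 4)) (w : List B)
    (hw : w = ks.foldr subst [l12, l21]) :
    w.count l12 = w.count l21 ∧ w.count l23 = w.count l32 ∧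
    w.count l34 = w.count l43 ∧ w.count l45 = w.count l54 := by
  subst hw
  induction ks with
  | nil => decide
  | cons k ks ih =>
    obtain ⟨h1, h2, h3, h4⟩ := ih
    rw [List.foldr_cons]
    simp only [count_subst, h1, h2, h3, h4]
    fin_cases k <;> simp [r, List.count_cons, beq_iff_B] <;> omega
end

section
/- Let w be any word obtained from the two-letter word 1²2¹ by a finite (possibly empty) composition of the substitutions r₀, r₁, r₂, r₃. Then w is a palindrome under base–exponent swap: reversing the word w and replacing each letter aᵇ by bᵃ yields the word w again. -/
open B

/-- The base–exponent swap on letters: aᵇ ↦ bᵃ. -/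
def bswap : B → B
  | l12 => l21
  | l21 => l12
  | l23 => l32
  | l32 => l23
  | l34 => l43
  | l43 => l34
  | l45 => l54
  | l54 => l45

theorem r_bswap (i : Fin 4) (x : B) : ((r i x).reverse.map bswap) = r i (bswap x) := by
  fin_cases i <;> cases x <;> rfl

theorem subst_bswap (i : Fin 4) (w : List B) :
    (subst i w).reverse.map bswap = subst i (w.reverse.map bswap) := by
  induction w with
  | nil => rfl
  | cons x t ih =>
    simp only [subst, List.map_cons, List.flatten_cons, List.reverse_append, List.map_append,
      List.reverse_cons, List.flatten_append, List.map_nil, List.flatten_nil,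
      List.append_nil] at ih ⊢
    rw [ih, r_bswap]

theorem stmt13 (ks : List (Fin 4)) (w : List B)
    (hw : w = ks.foldr subst [l12, l21]) :
    w.reverse.map bswap = w := by
  subst hw
  induction ks with
  | nil => rfl
  | cons k t ih => rw [List.foldr_cons, subst_bswap, ih]
end

section
/- (i) For every natural number n, σ₀ⁿ·σ₁·(1,0)ᵀ = ((n+1)φ, 1)ᵀ. (ii) Consequently, every positive even integer occurs as the length of a word obtained from 1²2¹ by a finite (possibly empty) composition of the substitutions: for every integer m ≥ 1 there exist k₀, …, kₙ ∈ {0,1,2,3} (or the empty composition) such that the word r_{k₀}∘⋯∘r_{kₙ}(1²2¹) has length exactly 2m. -/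
noncomputable section
open Matrix

open B

theorem aux_beq (a b : B) : (a == b) = decide (a = b) := by
  cases a <;> cases b <;> rfl

theorem aux_step (w : List B) : (subst 0 w).length = w.length + nc w + 2 * nd w ∧
    nc (subst 0 w) = nc w ∧ nd (subst 0 w) = nd w := by
  induction w with
  | nil => simp [subst, nc, nd]
  | cons a w ih =>
    simp only [subst, nc, nd] at ih ⊢
    obtain ⟨h1, h2, h3⟩ := ih
    cases a <;> simp [r, List.count_cons, aux_beq] at h1 h2 h3 ⊢ <;> omega

theorem aux_iter (n : ℕ) :
    ((List.replicate n (0 : Fin 4) ++ [1]).foldr subst [l12, l21]).length = 2 * (n + 2) ∧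
    nc ((List.replicate n (0 : Fin 4) ++ [1]).foldr subst [l12, l21]) = 2 ∧
    nd ((List.replicate n (0 : Fin 4) ++ [1]).foldr subst [l12, l21]) = 0 := by
  induction n with
  | zero => decide
  | succ n ih =>
    rw [List.replicate_succ, List.cons_append, List.foldr_cons]
    obtain ⟨h1, h2, h3⟩ := ih
    obtain ⟨g1, g2, g3⟩ := aux_step ((List.replicate n (0 : Fin 4) ++ [1]).foldr subst [l12, l21])
    refine ⟨?_, ?_, ?_⟩ <;> omega

theorem stmt16 :
    (∀ n : ℕ, ((σ 0) ^ n * σ 1).mulVec ![1, 0] = ![((n : ℝ) + 1) * φ, 1]) ∧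
    (∀ m : ℕ, 1 ≤ m → ∃ ks : List (Fin 4),
      (ks.foldr subst [l12, l21]).length = 2 * m) := by
  refine ⟨fun n => ?_, fun m hm => ?_⟩
  · induction n with
    | zero => ext i; fin_cases i <;> simp [σ, Matrix.mulVec, dotProduct, Fin.sum_univ_two]
    | succ n ih =>
      rw [pow_succ', Matrix.mul_assoc, ← Matrix.mulVec_mulVec, ih]
      ext i
      fin_cases i
      · simp [σ, Matrix.mulVec, dotProduct, Fin.sum_univ_two]
        ring
      · simp [σ, Matrix.mulVec, dotProduct, Fin.sum_univ_two]
  · rcases Nat.lt_or_ge m 2 with h | h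
    · refine ⟨[], ?_⟩
      simp
      omega
    · obtain ⟨n, rfl⟩ := Nat.exists_eq_add_of_le' h
      exact ⟨_, (aux_iter n).1⟩
end
end

section
/- Let M be the 6×6 real matrix with rows (0, 0, 1/4, 1/4, 1/4, 1/4), (1, 0, 0, 0, 0, 0), (0, 1/4, 0, 1/4, 1/4, 1/4), (0, 1/4, 1/4, 1/4, 1/4, 0), (0, 1/4, 1/4, 1/4, 0, 1/4), (0, 1/4, 1/4, 0, 1/4, 1/4). Then the powers Mⁿ converge entrywise, as n → ∞, to the 6×6 matrix all of whose entries equal 1/6. -/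
noncomputable section
open Matrix

/-- The stochastic matrix of the directed graph recording the action of the maps
σ₀, σ₁, σ₂, σ₃ on the six surfaces A, B, C, D, E, F. -/
noncomputable def M : Matrix (Fin 6) (Fin 6) ℝ :=
  !![0, 0, 1/4, 1/4, 1/4, 1/4;
     1, 0, 0, 0, 0, 0;
     0, 1/4, 0, 1/4, 1/4, 1/4;
     0, 1/4, 1/4, 1/4, 1/4, 0;
     0, 1/4, 1/4, 1/4, 0, 1/4;
     0, 1/4, 1/4, 0, 1/4, 1/4]

lemma M_rec (n : ℕ) (j : Fin 6) :
    (M ^ (n+1)) 0 j = ((M^n) 2 j + (M^n) 3 j + (M^n) 4 j + (M^n) 5 j)/4 ∧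
    (M ^ (n+1)) 1 j = (M^n) 0 j ∧
    (M ^ (n+1)) 2 j = ((M^n) 1 j + (M^n) 3 j + (M^n) 4 j + (M^n) 5 j)/4 ∧
    (M ^ (n+1)) 3 j = ((M^n) 1 j + (M^n) 2 j + (M^n) 3 j + (M^n) 4 j)/4 ∧
    (M ^ (n+1)) 4 j = ((M^n) 1 j + (M^n) 2 j + (M^n) 3 j + (M^n) 5 j)/4 ∧
    (M ^ (n+1)) 5 j = ((M^n) 1 j + (M^n) 2 j + (M^n) 4 j + (M^n) 5 j)/4 := by
  rw [pow_succ']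
  generalize M ^ n = X
  refine ⟨?_, ?_, ?_, ?_, ?_, ?_⟩ <;>
    rw [Matrix.mul_apply, Fin.sum_univ_six] <;> simp [M] <;> ring

lemma M_sum (n : ℕ) (j : Fin 6) :
    (M^n) 0 j + (M^n) 1 j + (M^n) 2 j + (M^n) 3 j + (M^n) 4 j + (M^n) 5 j = 1 := by
  induction n with
  | zero => fin_cases j <;> simp [Matrix.one_apply]
  | succ n ih =>
    obtain ⟨h0, h1, h2, h3, h4, h5⟩ := M_rec n j
    linarith

lemma M_step (n : ℕ) (j : Fin 6) (c : ℝ) (h : ∀ i, |(M^n) i j - 1/6| ≤ c) :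
    ∀ i, |(M^(n+2)) i j - 1/6| ≤ 2/3 * c := by
  obtain ⟨h0, h1, h2, h3, h4, h5⟩ := M_rec n j
  obtain ⟨k0, k1, k2, k3, k4, k5⟩ := M_rec (n+1) j
  have hs := M_sum n j
  simp only [abs_le] at h ⊢
  have a0 := h 0
  have a1 := h 1
  have a2 := h 2
  have a3 := h 3
  have a4 := h 4
  have a5 := h 5
  intro i
  fin_cases i <;> simp only [Fin.zero_eta, Fin.mk_one, Fin.reduceFinMk] <;>
    constructor <;> linarith

lemma M_bound (j : Fin 6) (n : ℕ) : ∀ i, |(M^n) i j - 1/6| ≤ (2/3 : ℝ)^(n/2) := by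
  induction n using Nat.twoStepInduction with
  | zero =>
    intro i
    by_cases h : i = j <;> simp [Matrix.one_apply, h, abs_le] <;> norm_num
  | one =>
    intro i
    fin_cases i <;> fin_cases j <;> simp [M, abs_le] <;> norm_num
  | more n ih _ =>
    intro i
    have := M_step n j _ ih i
    rwa [show (n+2)/2 = n/2+1 by omega, pow_succ' (2/3 : ℝ)]

theorem stmt18 :
    ∀ i j : Fin 6,
      Filter.Tendsto (fun n : ℕ => (M ^ n) i j) Filter.atTop (nhds (1 / 6)) := by
  intro i j
  rw [tendsto_iff_norm_sub_tendsto_zero]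
  refine squeeze_zero (fun _ => norm_nonneg _) (fun n => M_bound j n i) ?_
  exact (tendsto_pow_atTop_nhds_zero_of_lt_one (by norm_num) (by norm_num)).comp
    (Nat.tendsto_div_const_atTop (by norm_num))
end
end
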